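/- arXiv:2406.09370 — 2 statements merged into one kernel-verified Lean document; each statement's English description precedes it below -/
import Mathlib

section
/- Let ℓ : Z × H → [0,K] be a measurable function, let π be a probability measure on H that is independent of the data, let D be a probability measure on Z, and let t ∈ ℝ and δ ∈ (0,1). If S = (z_1,…,z_m) is an i.i.d. sample of size m from D, then with probability at least 1 − δ over the choice of S: log E_{h∼π}[e^{t((1/m) Σ_{i=1}^m ℓ(z_i,h) − E_{z∼D} ℓ(z,h))}] ≤ t² K²/(8m) + log(1/δ). -/
open MeasureTheory Real

open ProbabilityTheory in
/-- Hoeffding's lemma for the empirical mean of an i.i.d. sample of a `[0, K]`-valued variable. -/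
lemma integral_exp_empirical_mean_sub_le {Z : Type*} [MeasurableSpace Z] {f : Z → ℝ}
    (hf : Measurable f) {K : ℝ} (hb : ∀ z, f z ∈ Set.Icc 0 K)
    (D : Measure Z) [IsProbabilityMeasure D] (t : ℝ) {m : ℕ} (hm : 0 < m) :
    ∫ S, exp (t * ((∑ i, f (S i)) / m - ∫ z, f z ∂D)) ∂(Measure.pi fun _ : Fin m => D) ≤
      exp (t ^ 2 * K ^ 2 / (8 * m)) := by
  have hm' : (m : ℝ) ≠ 0 := by positivity
  have hsub := (hasSubgaussianMGF_of_mem_Icc (μ := D) hf.aemeasurable (ae_of_all D hb)).mgf_le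
    (t / m)
  have hprod (S : Fin m → Z) : exp (t * ((∑ i, f (S i)) / m - ∫ z, f z ∂D)) =
      ∏ i, exp (t / m * (f (S i) - ∫ z, f z ∂D)) := by
    rw [← exp_sum, ← Finset.mul_sum, Finset.sum_sub_distrib]
    simp only [Finset.sum_const, Finset.card_univ, Fintype.card_fin, nsmul_eq_mul]
    congr 1
    field_simp
  simp_rw [hprod]
  rw [integral_fintype_prod_eq_pow (fun z => exp (t / m * (f z - ∫ z, f z ∂D))),
    Fintype.card_fin]
  calc _ ≤ _ := pow_le_pow_left₀ (integral_nonneg fun _ => (exp_pos _).le) hsub m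
    _ = _ := by
      rw [← exp_nat_mul]
      congr 1
      simp only [sub_zero, NNReal.coe_pow, NNReal.coe_div, coe_nnnorm, norm_eq_abs,
        NNReal.coe_ofNat, div_pow, sq_abs]
      field_simp
      ring

/-- Lemma (exponential moment concentration): for a measurable loss `ℓ : Z × H → [0,K]`, a
data-free distribution `π` over `H`, any `t ∈ ℝ` and `δ ∈ (0,1)`, with probability at least
`1 − δ` over an i.i.d. sample `S ∼ D^m`:
`log E_{h∼π} e^{t((1/m)∑ᵢ ℓ(zᵢ,h) − E_z ℓ(z,h))} ≤ t²K²/(8m) + log(1/δ)`. -/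
theorem exponential_moment_concentration {H Z : Type*} [MeasurableSpace H] [MeasurableSpace Z]
    (ℓ : Z → H → ℝ) (hℓ : Measurable (Function.uncurry ℓ))
    (K : ℝ) (hb : ∀ z h, ℓ z h ∈ Set.Icc 0 K)
    (pr : Measure H) [IsProbabilityMeasure pr]
    (D : Measure Z) [IsProbabilityMeasure D]
    (t : ℝ) (δ : ℝ) (hδ : δ ∈ Set.Ioo (0 : ℝ) 1)
    (m : ℕ) (hm : 0 < m) :
    ENNReal.ofReal (1 - δ) ≤
      (Measure.pi fun _ : Fin m => D)
        {S | Real.log (∫ h, Real.exp (t * ((∑ i, ℓ (S i) h) / m - ∫ z, ℓ z h ∂D)) ∂pr) ≤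
          t ^ 2 * K ^ 2 / (8 * m) + Real.log (1 / δ)} := by
  have hm' : (0 : ℝ) < m := by positivity
  let F : (Fin m → Z) → H → ℝ := fun S h =>
    exp (t * ((∑ i, ℓ (S i) h) / m - ∫ z, ℓ z h ∂D))
  let W : (Fin m → Z) → ℝ := fun S => ∫ h, F S h ∂pr
  let P := Measure.pi fun _ : Fin m => D
  have hmean : Measurable fun h => ∫ z, ℓ z h ∂D :=
    (StronglyMeasurable.integral_prod_left' hℓ.stronglyMeasurable).measurable
  have hF : Measurable (Function.uncurry F) := by
    have hs : Measurable fun p : (Fin m → Z) × H => ∑ i, ℓ (p.1 i) p.2 := by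
      refine Finset.measurable_sum _ fun i _ => ?_
      have hp : Measurable fun p : (Fin m → Z) × H => (p.1 i, p.2) := by fun_prop
      exact hℓ.comp hp
    exact (((hs.div_const _).sub (hmean.comp measurable_snd)).const_mul t).exp
  have hbound (S : Fin m → Z) (h : H) : F S h ≤ exp (|t| * K) := by
    have hs : (∑ i, ℓ (S i) h) / m ∈ Set.Icc 0 K := by
      refine ⟨div_nonneg (Finset.sum_nonneg fun i _ => (hb _ _).1) hm'.le, ?_⟩
      rw [div_le_iff₀ hm']
      simpa [mul_comm] using Finset.sum_le_card_nsmul Finset.univ _ K fun i _ => (hb (S i) h).2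
    have he : ∫ z, ℓ z h ∂D ∈ Set.Icc 0 K := by
      refine ⟨integral_nonneg fun z => (hb z h).1, ?_⟩
      simpa using integral_mono_of_nonneg (ae_of_all D fun z => (hb z h).1)
        (integrable_const K) (ae_of_all D fun z => (hb z h).2)
    refine exp_le_exp.2 ((le_abs_self _).trans ?_)
    rw [abs_mul]
    gcongr
    exact abs_le.2 ⟨by linarith [hs.1, he.2], by linarith [hs.2, he.1]⟩
  have hFint : Integrable (Function.uncurry F) (P.prod pr) :=
    Integrable.of_bound hF.aestronglyMeasurable (exp (|t| * K)) <|
      ae_of_all _ fun p => by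
        simpa [F, Function.uncurry] using hbound p.1 p.2
  have hWpos (S : Fin m → Z) : 0 < W S := by
    refine integral_exp_pos (Integrable.of_bound ?_ (exp (|t| * K)) (ae_of_all _ fun h => ?_))
    · exact (hF.comp measurable_prodMk_left).aestronglyMeasurable
    · simpa [F] using hbound S h
  have hWle : ∫ S, W S ∂P ≤ exp (t ^ 2 * K ^ 2 / (8 * m)) := by
    rw [integral_integral_swap hFint]
    calc _ ≤ ∫ _, exp (t ^ 2 * K ^ 2 / (8 * m)) ∂pr :=
          integral_mono hFint.integral_prod_right (integrable_const _) fun h =>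
            integral_exp_empirical_mean_sub_le (hℓ.comp measurable_prodMk_right)
              (fun z => hb z h) D t hm
      _ = _ := by simp
  set B := exp (t ^ 2 * K ^ 2 / (8 * m)) with hB
  have hBpos : 0 < B := exp_pos _
  have hmarkov : P.real {S | B / δ ≤ W S} ≤ δ := by
    have := (mul_meas_ge_le_integral_of_nonneg (ae_of_all P fun S => (hWpos S).le)
      hFint.integral_prod_left (B / δ)).trans hWle
    rw [div_mul_eq_mul_div, div_le_iff₀ hδ.1] at this
    exact le_of_mul_le_mul_left this hBpos
  have hWmeas : Measurable W :=
    (StronglyMeasurable.integral_prod_right' hF.stronglyMeasurable).measurable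
  have hmeas : MeasurableSet {S | B / δ ≤ W S} := measurableSet_le measurable_const hWmeas
  calc ENNReal.ofReal (1 - δ) ≤ ENNReal.ofReal (P.real {S | B / δ ≤ W S}ᶜ) := by
        rw [probReal_compl_eq_one_sub hmeas]
        exact ENNReal.ofReal_le_ofReal (by linarith)
    _ = P {S | B / δ ≤ W S}ᶜ := ofReal_measureReal
    _ ≤ _ := measure_mono fun S hS => by
        have hlt : W S < B / δ := not_le.1 hS
        calc log (W S) ≤ log (B / δ) := log_le_log (hWpos S) hlt.le
          _ = _ := by
            rw [div_eq_mul_one_div, log_mul hBpos.ne' (one_div_pos.2 hδ.1).ne', hB, log_exp]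
end

section
/- Assume the loss satisfies ℓ(h,z) ∈ [0,K]. Fix a probability measure Q_s on H, probability measures D_s, D_t on Z, and λ_t > 0. For a sample S_t ∈ Z^{m_t}, let Q̂^{λ_t}_{s:t} be the empirical Gibbs posterior with prior Q_s, sample S_t and temperature λ_t. If S_t is an i.i.d. sample of size m_t from D_t, then E_{S_t∼D_t^{m_t}}[L(Q̂^{λ_t}_{s:t}, D_s)] ≤ inf over probability measures Q on H absolutely continuous w.r.t. Q_s of { L(Q, D_t) + (1/λ_t) KL(Q||Q_s) } + λ_t K²/(8 m_t) + (1/λ_t) log E_{h∼Q_s}[e^{λ_t(L(h,D_s) − L(h,D_t))}]. -/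
open MeasureTheory Real

/-- Expected loss `L(h, D) = E_{z∼D} ℓ(h, z)`. -/
noncomputable def expLoss {H Z : Type*} [MeasurableSpace Z] (ℓ : H → Z → ℝ) (h : H)
    (D : Measure Z) : ℝ :=
  ∫ z, ℓ h z ∂D

/-- Empirical loss `L̂(h, S) = (1/m) ∑_{j=1}^m ℓ(h, z_j)`. -/
noncomputable def empLoss {H Z : Type*} (ℓ : H → Z → ℝ) {m : ℕ} (h : H) (S : Fin m → Z) : ℝ :=
  (∑ j, ℓ h (S j)) / m

/-- The Kullback–Leibler divergence `KL(Q‖P) = E_{h∼Q}[log (dQ/dP)(h)]`. -/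
noncomputable def klReal {H : Type*} [MeasurableSpace H] (Q P : Measure H) : ℝ :=
  ∫ h, Real.log ((Q.rnDeriv P h).toReal) ∂Q

/-- The measure with density with respect to `P` proportional to `e^{−g h}`. -/
noncomputable def gibbs {H : Type*} [MeasurableSpace H] (P : Measure H) (g : H → ℝ) :
    Measure H :=
  P.withDensity fun h => ENNReal.ofReal (Real.exp (-g h) / ∫ h', Real.exp (-g h') ∂P)

/-- Jensen's inequality for the exponential. -/
lemma integral_le_log_integral_exp {α : Type*} [MeasurableSpace α] {μ : Measure α}
    [IsProbabilityMeasure μ] {f : α → ℝ} (hf : Integrable f μ)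
    (hexp : Integrable (fun x => Real.exp (f x)) μ) :
    ∫ x, f x ∂μ ≤ Real.log (∫ x, Real.exp (f x) ∂μ) := by
  have hpos : 0 < ∫ x, Real.exp (f x) ∂μ := integral_exp_pos hexp
  set c := Real.log (∫ x, Real.exp (f x) ∂μ) with hc
  have h1 : ∫ x, (f x + (1 - c)) ∂μ ≤ ∫ x, Real.exp (f x) * Real.exp (-c) ∂μ := by
    refine integral_mono (hf.add (integrable_const _)) (hexp.mul_const _) fun x => ?_
    have := Real.add_one_le_exp (f x + -c)
    rw [Real.exp_add] at this
    dsimp only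
    linarith
  rw [integral_add hf (integrable_const _), integral_mul_const, Real.exp_neg, hc,
    Real.exp_log hpos, mul_inv_cancel₀ hpos.ne'] at h1
  simp only [integral_const, probReal_univ, smul_eq_mul, one_mul] at h1
  linarith

/-- The Donsker–Varadhan inequality. -/
lemma integral_le_integral_llr_add_log_integral_exp {α : Type*} [MeasurableSpace α]
    {Q P : Measure α} [IsProbabilityMeasure Q] [IsProbabilityMeasure P] (hQP : Q ≪ P)
    (hllr : Integrable (llr Q P) Q) {f : α → ℝ} (hf : Integrable f Q)
    (hexp : Integrable (fun x => Real.exp (f x)) P) :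
    ∫ x, f x ∂Q ≤ ∫ x, llr Q P x ∂Q + Real.log (∫ x, Real.exp (f x) ∂P) := by
  have : IsProbabilityMeasure (P.tilted f) := isProbabilityMeasure_tilted hexp
  have h := InformationTheory.integral_llr_add_sub_measure_univ_nonneg
    (hQP.trans (absolutelyContinuous_tilted hexp))
    (integrable_llr_tilted_right hQP hf hllr hexp)
  rw [integral_llr_tilted_right hQP hf hexp hllr] at h
  simp only [probReal_univ] at h
  linarith

/-- A bounded measurable function and its exponential are integrable. -/
lemma integrable_and_integrable_exp_of_mem_Icc {α : Type*} [MeasurableSpace α] {μ : Measure α}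
    [IsFiniteMeasure μ] {f : α → ℝ} {a b : ℝ} (hf : Measurable f)
    (hb : ∀ x, f x ∈ Set.Icc a b) :
    Integrable f μ ∧ Integrable (fun x => Real.exp (f x)) μ :=
  ⟨Integrable.of_mem_Icc a b hf.aemeasurable (ae_of_all _ hb),
    Integrable.of_mem_Icc (Real.exp a) (Real.exp b) hf.exp.aemeasurable
      (ae_of_all _ fun x => ⟨Real.exp_le_exp.2 (hb x).1, Real.exp_le_exp.2 (hb x).2⟩)⟩

/-- The Gibbs posterior satisfies the change-of-measure bound
`E_{gibbs P g}[u] ≤ log E_P[e^{u - g}] + KL(Q‖P) + E_Q[g]` for every `Q ≪ P`. -/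
lemma integral_gibbs_le {α : Type*} [MeasurableSpace α] {Q P : Measure α}
    [IsProbabilityMeasure Q] [IsProbabilityMeasure P] (hQP : Q ≪ P)
    (hllr : Integrable (llr Q P) Q) {u g : α → ℝ} {a b c d : ℝ}
    (hu : Measurable u) (hub : ∀ x, u x ∈ Set.Icc a b)
    (hg : Measurable g) (hgb : ∀ x, g x ∈ Set.Icc c d) :
    ∫ x, u x ∂(gibbs P g) ≤
      Real.log (∫ x, Real.exp (u x - g x) ∂P) + klReal Q P + ∫ x, g x ∂Q := by
  have hgb' : ∀ x, -g x ∈ Set.Icc (-d) (-c) := fun x =>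
    ⟨neg_le_neg (hgb x).2, neg_le_neg (hgb x).1⟩
  have hexp : Integrable (fun x => Real.exp (-g x)) P :=
    (integrable_and_integrable_exp_of_mem_Icc (μ := P) hg.neg hgb').2
  have hgibbs : gibbs P g = P.tilted fun x => -g x := rfl
  have : IsProbabilityMeasure (P.tilted fun x => -g x) := isProbabilityMeasure_tilted hexp
  have hsub : ∀ x, u x - g x ∈ Set.Icc (a - d) (b - c) := fun x =>
    ⟨sub_le_sub (hub x).1 (hgb x).2, sub_le_sub (hub x).2 (hgb x).1⟩
  have hexp' : Integrable (fun x => Real.exp (u x - g x)) P :=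
    (integrable_and_integrable_exp_of_mem_Icc (μ := P) (hu.sub hg) hsub).2
  obtain ⟨hu1, hu2⟩ :=
    integrable_and_integrable_exp_of_mem_Icc (μ := P.tilted fun x => -g x) hu hub
  have h1 := integral_le_log_integral_exp hu1 hu2
  have h2 := integral_le_integral_llr_add_log_integral_exp hQP hllr
    (integrable_and_integrable_exp_of_mem_Icc (μ := Q) hg.neg hgb').1 hexp
  have h3 : ∫ x, Real.exp (((fun x => -g x) + u) x) ∂P = ∫ x, Real.exp (u x - g x) ∂P := by
    refine integral_congr_ae (ae_of_all _ fun x => ?_)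
    simp only [Pi.add_apply]
    congr 1
    ring
  rw [integral_exp_tilted, h3,
    Real.log_div (integral_exp_pos hexp').ne' (integral_exp_pos hexp).ne'] at h1
  simp only [Pi.neg_apply, integral_neg] at h2
  have h4 : klReal Q P = ∫ x, llr Q P x ∂Q := rfl
  rw [hgibbs, h4]
  linarith

lemma expLoss_mem_Icc {H Z : Type*} [MeasurableSpace Z] {ℓ : H → Z → ℝ} {K : ℝ}
    (hb : ∀ h z, ℓ h z ∈ Set.Icc 0 K) (h : H) (hm : Measurable (ℓ h))
    (D : Measure Z) [IsProbabilityMeasure D] : expLoss ℓ h D ∈ Set.Icc 0 K := by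
  refine ⟨integral_nonneg fun z => (hb h z).1, ?_⟩
  have := integral_mono (Integrable.of_mem_Icc 0 K hm.aemeasurable (ae_of_all D (hb h)))
    (integrable_const K) fun z => (hb h z).2
  simpa [expLoss] using this

lemma empLoss_mem_Icc {H Z : Type*} {ℓ : H → Z → ℝ} {K : ℝ}
    (hb : ∀ h z, ℓ h z ∈ Set.Icc 0 K) {m : ℕ} (hm : 0 < m) (h : H) (S : Fin m → Z) :
    empLoss ℓ h S ∈ Set.Icc 0 K := by
  have hm' : (0 : ℝ) < m := Nat.cast_pos.2 hm
  refine ⟨div_nonneg (Finset.sum_nonneg fun j _ => (hb h _).1) hm'.le, ?_⟩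
  rw [empLoss, div_le_iff₀ hm']
  calc ∑ j, ℓ h (S j) ≤ ∑ _j : Fin m, K := Finset.sum_le_sum fun j _ => (hb h _).2
    _ = K * m := by simp [mul_comm]

lemma measurable_uncurry_empLoss {H Z : Type*} [MeasurableSpace H] [MeasurableSpace Z]
    {ℓ : H → Z → ℝ} (hℓ : Measurable (Function.uncurry ℓ)) (m : ℕ) :
    Measurable fun p : H × (Fin m → Z) => empLoss ℓ p.1 p.2 := by
  have (j : Fin m) : Measurable fun p : H × (Fin m → Z) => ℓ p.1 (p.2 j) :=
    hℓ.comp (measurable_fst.prodMk ((measurable_pi_apply j).comp measurable_snd))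
  exact (Finset.measurable_sum _ fun j _ => this j).div_const _

lemma measurable_expLoss {H Z : Type*} [MeasurableSpace H] [MeasurableSpace Z]
    {ℓ : H → Z → ℝ} (hℓ : Measurable (Function.uncurry ℓ)) (D : Measure Z) [SFinite D] :
    Measurable fun h => expLoss ℓ h D :=
  (StronglyMeasurable.integral_prod_right hℓ.stronglyMeasurable).measurable

lemma integral_empLoss {H Z : Type*} [MeasurableSpace Z] {ℓ : H → Z → ℝ} {K : ℝ}
    (hb : ∀ h z, ℓ h z ∈ Set.Icc 0 K) (h : H) (hmeas : Measurable (ℓ h))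
    (D : Measure Z) [IsProbabilityMeasure D] {m : ℕ} (hm : 0 < m) :
    ∫ S, empLoss ℓ h S ∂(Measure.pi fun _ : Fin m => D) = expLoss ℓ h D := by
  have hint : Integrable (ℓ h) D := Integrable.of_mem_Icc 0 K hmeas.aemeasurable
    (ae_of_all D (hb h))
  have hm' : (m : ℝ) ≠ 0 := Nat.cast_ne_zero.2 hm.ne'
  have hcomp (j : Fin m) :
      ∫ S : Fin m → Z, ℓ h (S j) ∂(Measure.pi fun _ : Fin m => D) = expLoss ℓ h D :=
    integral_comp_eval (μ := fun _ : Fin m => D) hint.aestronglyMeasurable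
  simp only [empLoss]
  rw [integral_div, integral_finsetSum _ fun j _ =>
    integrable_comp_eval (μ := fun _ : Fin m => D) hint]
  simp only [hcomp, Finset.sum_const, Finset.card_univ, Fintype.card_fin, nsmul_eq_mul]
  field_simp

/-- Hoeffding's bound on the moment generating function of the deviation of the empirical loss. -/
lemma integral_exp_expLoss_sub_empLoss_le {H Z : Type*} [MeasurableSpace Z] {ℓ : H → Z → ℝ}
    {K : ℝ} (hb : ∀ h z, ℓ h z ∈ Set.Icc 0 K) (h : H) (hmeas : Measurable (ℓ h))
    (D : Measure Z) [IsProbabilityMeasure D] {m : ℕ} (hm : 0 < m) (t : ℝ) :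
    ∫ S, Real.exp (t * (expLoss ℓ h D - empLoss ℓ h S)) ∂(Measure.pi fun _ : Fin m => D) ≤
      Real.exp (t ^ 2 * K ^ 2 / (8 * m)) := by
  have hm' : (m : ℝ) ≠ 0 := Nat.cast_ne_zero.2 hm.ne'
  have hprod (S : Fin m → Z) : Real.exp (t * (expLoss ℓ h D - empLoss ℓ h S)) =
      ∏ j, Real.exp (-(t / m) * (ℓ h (S j) - expLoss ℓ h D)) := by
    rw [← Real.exp_sum, ← Finset.mul_sum, Finset.sum_sub_distrib]
    simp only [empLoss, Finset.sum_const, Finset.card_univ, Fintype.card_fin, nsmul_eq_mul]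
    congr 1
    field_simp
    ring
  have hmgf := (ProbabilityTheory.hasSubgaussianMGF_of_mem_Icc (μ := D) hmeas.aemeasurable
    (ae_of_all _ (hb h))).mgf_le (-(t / m))
  simp only [hprod]
  rw [integral_fintype_prod_eq_pow fun z => Real.exp (-(t / m) * (ℓ h z - expLoss ℓ h D)),
    Fintype.card_fin]
  calc _ ≤ _ := pow_le_pow_left₀ (integral_nonneg fun z => (Real.exp_pos _).le) hmgf m
    _ = _ := by
      rw [← Real.exp_nat_mul]
      congr 1
      simp only [sub_zero, NNReal.coe_pow, NNReal.coe_div, coe_nnnorm, Real.norm_eq_abs, div_pow,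
        sq_abs, NNReal.coe_ofNat]
      field_simp
      ring

/-- Oracle bound for the empirical Gibbs posterior `Q̂^{λ_t}_{s:t} ∝ Q_s · e^{−λ_t L̂(·,S_t)}`:
`E_{S_t∼D_t^{m_t}} L(Q̂^{λ_t}_{s:t}, D_s)
  ≤ inf_{Q ≪ Q_s} { L(Q, D_t) + (1/λ_t) KL(Q‖Q_s) } + λ_t K²/(8 m_t)
    + (1/λ_t) log E_{h∼Q_s} e^{λ_t (L(h,D_s) − L(h,D_t))}`. -/
theorem gibbs_oracle_two_task {H Z : Type*} [MeasurableSpace H] [MeasurableSpace Z]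
    (ℓ : H → Z → ℝ) (hℓ : Measurable (Function.uncurry ℓ))
    (K : ℝ) (hb : ∀ h z, ℓ h z ∈ Set.Icc 0 K)
    (Qs : Measure H) [IsProbabilityMeasure Qs]
    (Ds Dt : Measure Z) [IsProbabilityMeasure Ds] [IsProbabilityMeasure Dt]
    (lamt : ℝ) (hlam : 0 < lamt) (mt : ℕ) (hmt : 0 < mt) :
    (∫ St, (∫ h, expLoss ℓ h Ds ∂(gibbs Qs fun h => lamt * empLoss ℓ h St))
        ∂(Measure.pi fun _ : Fin mt => Dt)) ≤
      sInf {x : ℝ | ∃ Q : Measure H, IsProbabilityMeasure Q ∧ Q ≪ Qs ∧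
          Integrable (fun h => Real.log ((Q.rnDeriv Qs h).toReal)) Q ∧
          x = (∫ h, expLoss ℓ h Dt ∂Q) + (1 / lamt) * klReal Q Qs} +
        lamt * K ^ 2 / (8 * mt) +
        (1 / lamt) * Real.log (∫ h, Real.exp (lamt * (expLoss ℓ h Ds - expLoss ℓ h Dt)) ∂Qs) := by
  have hmeas (h : H) : Measurable (ℓ h) := hℓ.comp measurable_prodMk_left
  have hLs := measurable_expLoss hℓ Ds
  have hLt := measurable_expLoss hℓ Dt
  have hemp := measurable_uncurry_empLoss hℓ mt
  have hLsb (h : H) := expLoss_mem_Icc hb h (hmeas h) Ds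
  have hLtb (h : H) := expLoss_mem_Icc hb h (hmeas h) Dt
  have hempb (h : H) (S : Fin mt → Z) := empLoss_mem_Icc hb hmt h S
  set μS := Measure.pi fun _ : Fin mt => Dt
  set W : H → (Fin mt → Z) → ℝ := fun h S => lamt * expLoss ℓ h Ds - lamt * empLoss ℓ h S
  have hW : Measurable fun p : H × (Fin mt → Z) => W p.1 p.2 :=
    ((hLs.comp measurable_fst).const_mul _).sub (hemp.const_mul _)
  have hWb (h : H) (S : Fin mt → Z) : W h S ∈ Set.Icc (-(lamt * K)) (lamt * K) := by
    have h1 := mul_le_mul_of_nonneg_left (hLsb h).2 hlam.le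
    have h2 := mul_le_mul_of_nonneg_left (hempb h S).2 hlam.le
    have h3 := mul_nonneg hlam.le (hLsb h).1
    have h4 := mul_nonneg hlam.le (hempb h S).1
    constructor <;> simp only [W] <;> linarith
  set X : (Fin mt → Z) → ℝ := fun S => ∫ h, Real.exp (W h S) ∂Qs
  have hexpW : Integrable (fun p : H × (Fin mt → Z) => Real.exp (W p.1 p.2)) (Qs.prod μS) :=
    (integrable_and_integrable_exp_of_mem_Icc hW fun p => hWb p.1 p.2).2
  have hexpWS (S : Fin mt → Z) : Integrable (fun h => Real.exp (W h S)) Qs :=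
    (integrable_and_integrable_exp_of_mem_Icc (hW.comp measurable_prodMk_right)
      fun h => hWb h S).2
  have hXpos (S : Fin mt → Z) : 0 < X S := integral_exp_pos (hexpWS S)
  have hXm : Measurable X := (StronglyMeasurable.integral_prod_left
    (f := fun h S => Real.exp (W h S)) hW.exp.stronglyMeasurable).measurable
  have hlogX (S : Fin mt → Z) : Real.log (X S) ∈ Set.Icc (-(lamt * K)) (lamt * K) := by
    have h1 := integral_mono (integrable_const _) (hexpWS S)
      fun h => Real.exp_le_exp.2 (hWb h S).1
    have h2 := integral_mono (hexpWS S) (integrable_const _)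
      fun h => Real.exp_le_exp.2 (hWb h S).2
    simp only [integral_const, probReal_univ, smul_eq_mul, one_mul] at h1 h2
    exact ⟨(Real.le_log_iff_exp_le (hXpos S)).2 h1, (Real.log_le_iff_le_exp (hXpos S)).2 h2⟩
  obtain ⟨hlogXi, hXi⟩ :=
    integrable_and_integrable_exp_of_mem_Icc (μ := μS) hXm.log hlogX
  have hjensen := integral_le_log_integral_exp hlogXi hXi
  simp only [fun S => Real.exp_log (hXpos S)] at hjensen
  set Y := ∫ h, Real.exp (lamt * (expLoss ℓ h Ds - expLoss ℓ h Dt)) ∂Qs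
  have hVi : Integrable (fun h => Real.exp (lamt * (expLoss ℓ h Ds - expLoss ℓ h Dt))) Qs := by
    refine (integrable_and_integrable_exp_of_mem_Icc (a := lamt * (0 - K)) (b := lamt * (K - 0))
      ((hLs.sub hLt).const_mul lamt) fun h => ⟨?_, ?_⟩).2
    · exact mul_le_mul_of_nonneg_left (sub_le_sub (hLsb h).1 (hLtb h).2) hlam.le
    · exact mul_le_mul_of_nonneg_left (sub_le_sub (hLsb h).2 (hLtb h).1) hlam.le
  have hYpos : 0 < Y := integral_exp_pos hVi
  have hXY : ∫ S, X S ∂μS ≤ Y * Real.exp (lamt ^ 2 * K ^ 2 / (8 * mt)) := by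
    rw [← integral_integral_swap (f := fun h S => Real.exp (W h S)) hexpW,
      ← integral_mul_const]
    refine integral_mono hexpW.integral_prod_left (hVi.mul_const _) fun h => ?_
    have hsplit (S : Fin mt → Z) : Real.exp (W h S) =
        Real.exp (lamt * (expLoss ℓ h Ds - expLoss ℓ h Dt)) *
          Real.exp (lamt * (expLoss ℓ h Dt - empLoss ℓ h S)) := by
      rw [← Real.exp_add]
      congr 1
      simp only [W]
      ring
    simp only [hsplit]
    rw [integral_const_mul]
    exact mul_le_mul_of_nonneg_left
      (integral_exp_expLoss_sub_empLoss_le hb h (hmeas h) Dt hmt lamt) (Real.exp_pos _).le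
  have hXpos' : 0 < ∫ S, X S ∂μS := by
    have := integral_exp_pos hXi
    simpa only [fun S => Real.exp_log (hXpos S)] using this
  have hlog : ∫ S, Real.log (X S) ∂μS ≤ Real.log Y + lamt ^ 2 * K ^ 2 / (8 * mt) := by
    refine hjensen.trans ((Real.log_le_log hXpos' hXY).trans_eq ?_)
    rw [Real.log_mul hYpos.ne' (Real.exp_pos _).ne', Real.log_exp]
  have key : (∫ S, (∫ h, expLoss ℓ h Ds ∂(gibbs Qs fun h => lamt * empLoss ℓ h S)) ∂μS) -
      lamt * K ^ 2 / (8 * mt) - (1 / lamt) * Real.log Y ≤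
      sInf {x : ℝ | ∃ Q : Measure H, IsProbabilityMeasure Q ∧ Q ≪ Qs ∧
          Integrable (fun h => Real.log ((Q.rnDeriv Qs h).toReal)) Q ∧
          x = (∫ h, expLoss ℓ h Dt ∂Q) + (1 / lamt) * klReal Q Qs} := by
    refine le_csInf ⟨_, Qs, inferInstance, Measure.AbsolutelyContinuous.rfl,
      (integrable_zero H ℝ Qs).congr (llr_self Qs).symm, rfl⟩ ?_
    rintro _ ⟨Q, hQ, hQP, hllr, rfl⟩
    have hempi : Integrable (fun p : H × (Fin mt → Z) => empLoss ℓ p.1 p.2) (Q.prod μS) :=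
      (integrable_and_integrable_exp_of_mem_Icc hemp fun p => hempb p.1 p.2).1
    have hpt (S : Fin mt → Z) :
        ∫ h, expLoss ℓ h Ds ∂(gibbs Qs fun h => lamt * empLoss ℓ h S) ≤
          (1 / lamt) * Real.log (X S) + (1 / lamt) * klReal Q Qs + ∫ h, empLoss ℓ h S ∂Q := by
      have := integral_gibbs_le hQP hllr (hLs.const_mul lamt)
        (fun h => ⟨mul_le_mul_of_nonneg_left (hLsb h).1 hlam.le,
          mul_le_mul_of_nonneg_left (hLsb h).2 hlam.le⟩)
        ((hemp.comp (measurable_prodMk_right (y := S))).const_mul lamt)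
        (fun h => ⟨mul_le_mul_of_nonneg_left (hempb h S).1 hlam.le,
          mul_le_mul_of_nonneg_left (hempb h S).2 hlam.le⟩)
      simp only [integral_const_mul, Function.comp_def] at this
      rw [← mul_le_mul_iff_right₀ hlam]
      refine this.trans_eq ?_
      simp only [X, W]
      field_simp
    have hint1 : Integrable (fun S => (1 / lamt) * Real.log (X S)) μS := hlogXi.const_mul _
    have hint2 : Integrable (fun S => ∫ h, empLoss ℓ h S ∂Q) μS := hempi.integral_prod_right
    have hint12 : Integrable
        (fun S => (1 / lamt) * Real.log (X S) + (1 / lamt) * klReal Q Qs) μS :=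
      hint1.add (integrable_const _)
    have hmono := integral_mono_of_nonneg (μ := μS)
      (ae_of_all _ fun S => integral_nonneg fun h => (hLsb h).1)
      (hint12.add hint2) (ae_of_all _ hpt)
    have hsum : ∫ S, ((1 / lamt) * Real.log (X S) + (1 / lamt) * klReal Q Qs +
        ∫ h, empLoss ℓ h S ∂Q) ∂μS = (1 / lamt) * (∫ S, Real.log (X S) ∂μS) +
          (1 / lamt) * klReal Q Qs + ∫ h, expLoss ℓ h Dt ∂Q := by
      rw [integral_add hint12 hint2,
        integral_add hint1 (integrable_const _), integral_const_mul,
        ← integral_integral_swap (f := fun h S => empLoss ℓ h S) hempi]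
      simp only [integral_const, probReal_univ, smul_eq_mul, one_mul]
      congr 2
      exact funext fun h => integral_empLoss hb h (hmeas h) Dt hmt
    have hmain := hmono.trans_eq hsum
    have hscale := mul_le_mul_of_nonneg_left hlog (one_div_pos.2 hlam).le
    have hcancel : (1 / lamt) * (Real.log Y + lamt ^ 2 * K ^ 2 / (8 * mt)) =
        (1 / lamt) * Real.log Y + lamt * K ^ 2 / (8 * mt) := by
      field_simp
    linarith
  linarith
end
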